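/- For every integer k ≥ 2, no real number is a Trott number in both base k²+1 and base k²+k; that is, T_{k²+1} ∩ T_{k²+k} = ∅. -/

import Mathlib

open Filter Topology

/-- Number of digits of `a` in base `b`. -/
def digLen (b a : ℕ) : ℕ := (Nat.digits b a).length

/-- Value of the finite continued fraction `[0; a₁, a₂, …, aₙ]`. -/
noncomputable def cfVal : List ℕ → ℝ
  | [] => 0
  | (h :: t) => 1 / ((h : ℝ) + cfVal t)

/-- `a` witnesses that `x` is a Trott number in base `b`: the `a i` (indexed from 0)
are positive, `x` is the value of the infinite continued fraction `[0; a 0, a 1, …]`,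
and the base-`b` expansion of `x` is the concatenation of the base-`b` digit strings
of the partial quotients. -/
def IsTrottWith (b : ℕ) (x : ℝ) (a : ℕ → ℕ) : Prop :=
  (∀ i, 0 < a i) ∧
  Tendsto (fun n => cfVal ((List.range n).map a)) atTop (𝓝 x) ∧
  x = ∑' i : ℕ, (a i : ℝ) / (b : ℝ) ^ (∑ j ∈ Finset.range (i + 1), digLen b (a j))

/-- `x` is a Trott number in base `b`. -/
def IsTrott (b : ℕ) (x : ℝ) : Prop := ∃ a, IsTrottWith b x a

/-- The set of Trott numbers in base `b`. -/
def TrottSet (b : ℕ) : Set ℝ := {x | IsTrott b x}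

/-- Value of the base-`b` concatenation `0.a₀a₁a₂…`. -/
noncomputable def concatVal (b : ℕ) (a : ℕ → ℕ) : ℝ :=
  ∑' i : ℕ, (a i : ℝ) / (b : ℝ) ^ (∑ j ∈ Finset.range (i + 1), digLen b (a j))

lemma concatVal_partial_le {b : ℕ} (hb : 2 ≤ b) (a : ℕ → ℕ) (n : ℕ) :
    ∑ i ∈ Finset.range n, (a i : ℝ) / (b : ℝ) ^ (∑ j ∈ Finset.range (i + 1), digLen b (a j))
      + 1 / (b : ℝ) ^ (∑ j ∈ Finset.range n, digLen b (a j)) ≤ 1 := by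
  induction n with
  | zero => simp
  | succ n ih =>
    refine le_trans ?_ ih
    rw [Finset.sum_range_succ, add_assoc]
    gcongr
    rw [Finset.sum_range_succ, ← add_div, pow_add]
    have hbpos : (0 : ℝ) < b := by positivity
    have h : (a n : ℝ) + 1 ≤ (b : ℝ) ^ digLen b (a n) := by
      exact_mod_cast Nat.lt_base_pow_length_digits (by omega)
    rw [div_le_div_iff₀ (by positivity) (by positivity), one_mul, mul_comm]
    gcongr

lemma concatVal_sum_range_le {b : ℕ} (hb : 2 ≤ b) (a : ℕ → ℕ) (n : ℕ) :
    ∑ i ∈ Finset.range n, (a i : ℝ) / (b : ℝ) ^ (∑ j ∈ Finset.range (i + 1), digLen b (a j))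
      ≤ 1 := by
  have h := concatVal_partial_le hb a n
  have : (0 : ℝ) ≤ 1 / (b : ℝ) ^ (∑ j ∈ Finset.range n, digLen b (a j)) := by positivity
  linarith

lemma concatVal_le_one {b : ℕ} (hb : 2 ≤ b) (a : ℕ → ℕ) : concatVal b a ≤ 1 :=
  Real.tsum_le_of_sum_range_le (fun _ => by positivity) (concatVal_sum_range_le hb a)

lemma concatVal_eq {b : ℕ} (hb : 2 ≤ b) (a : ℕ → ℕ) :
    concatVal b a = (a 0 + concatVal b (fun i => a (i + 1))) / (b : ℝ) ^ digLen b (a 0) := by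
  have hs : Summable fun i : ℕ =>
      (a i : ℝ) / (b : ℝ) ^ (∑ j ∈ Finset.range (i + 1), digLen b (a j)) :=
    summable_of_sum_range_le (fun _ => by positivity) (concatVal_sum_range_le hb a)
  rw [concatVal, hs.tsum_eq_zero_add, add_div, concatVal, ← tsum_div_const]
  simp only [zero_add, Finset.sum_range_one]
  congr 1
  refine tsum_congr fun i => ?_
  rw [Finset.sum_range_succ', pow_add, div_div]

lemma concatVal_nonneg (b : ℕ) (a : ℕ → ℕ) : 0 ≤ concatVal b a :=
  tsum_nonneg fun _ => by positivity

section ContinuedFraction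

/-- `x` is the value of the infinite continued fraction `[0; a₀, a₁, …]`. -/
def IsCF (a : ℕ → ℕ) (x : ℝ) : Prop :=
  Tendsto (fun n => cfVal ((List.range n).map a)) atTop (𝓝 x)

lemma cfVal_nonneg (l : List ℕ) : 0 ≤ cfVal l := by
  induction l with
  | nil => simp [cfVal]
  | cons h t ih => rw [cfVal]; positivity

lemma cfVal_map_range_succ (a : ℕ → ℕ) (n : ℕ) :
    cfVal ((List.range (n + 1)).map a) =
      1 / ((a 0 : ℝ) + cfVal ((List.range n).map fun i => a (i + 1))) := by
  rw [List.range_succ_eq_map, List.map_cons, List.map_map, cfVal]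
  rfl

lemma cfVal_map_range_le_one {a : ℕ → ℕ} (ha : ∀ i, 0 < a i) (n : ℕ) :
    cfVal ((List.range n).map a) ≤ 1 := by
  cases n with
  | zero => simp [cfVal]
  | succ n =>
    rw [cfVal_map_range_succ]
    have h1 : (1 : ℝ) ≤ a 0 := by exact_mod_cast ha 0
    have h2 := cfVal_nonneg ((List.range n).map fun i => a (i + 1))
    rw [div_le_one (by linarith)]
    linarith

variable {a : ℕ → ℕ} {x : ℝ}

lemma IsCF.pos (ha : ∀ i, 0 < a i) (h : IsCF a x) : 0 < x := by
  have h0 : (0 : ℝ) < 1 / (a 0 + 1) := by positivity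
  refine h0.trans_le (ge_of_tendsto ((tendsto_add_atTop_iff_nat 1).2 h) (.of_forall fun n => ?_))
  rw [cfVal_map_range_succ]
  have h1 : (0 : ℝ) < a 0 := by exact_mod_cast ha 0
  have h2 := cfVal_nonneg ((List.range n).map fun i => a (i + 1))
  have h3 := cfVal_map_range_le_one (a := fun i => a (i + 1)) (fun i => ha _) n
  gcongr

lemma IsCF.tail (ha : ∀ i, 0 < a i) (h : IsCF a x) :
    IsCF (fun i => a (i + 1)) (1 / x - a 0) := by
  have h1 := ((tendsto_const_nhds (x := (1 : ℝ))).div ((tendsto_add_atTop_iff_nat 1).2 h)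
    (h.pos ha).ne').sub_const (a 0 : ℝ)
  refine h1.congr fun n => ?_
  rw [Pi.div_apply, cfVal_map_range_succ, one_div_one_div]
  ring

lemma IsCF.lt_one (ha : ∀ i, 0 < a i) (h : IsCF a x) : x < 1 := by
  have h1 := (h.tail ha).pos fun i => ha _
  have h2 : (1 : ℝ) ≤ a 0 := by exact_mod_cast ha 0
  have h3 : 1 < 1 / x := by linarith
  exact (one_lt_div (h.pos ha)).1 h3

lemma IsCF.exists_tail (ha : ∀ i, 0 < a i) (h : IsCF a x) :
    ∃ y, IsCF (fun i => a (i + 1)) y ∧ 0 < y ∧ y < 1 ∧ x * (a 0 + y) = 1 := by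
  refine ⟨_, h.tail ha, (h.tail ha).pos fun i => ha _, (h.tail ha).lt_one fun i => ha _, ?_⟩
  have := (h.pos ha).ne'
  field_simp
  ring

end ContinuedFraction

lemma nat_eq_of_add_frac_eq {m n : ℕ} {u v : ℝ} (hu : 0 < u) (hu1 : u < 1) (hv : 0 < v)
    (hv1 : v < 1) (h : (m : ℝ) + u = n + v) : m = n := by
  have h1 : (m : ℝ) < n + 1 := by linarith
  have h2 : (n : ℝ) < m + 1 := by linarith
  have h3 : m < n + 1 := by exact_mod_cast h1
  have h4 : n < m + 1 := by exact_mod_cast h2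
  omega

/-- The relations that a Trott number imposes on its first two partial quotients. -/
lemma IsTrott.exists_two_steps {k b : ℕ} (hk : 1 ≤ k) (hb : k ^ 2 < b) (hb' : b < (k + 1) ^ 2)
    {x : ℝ} (hx : IsTrott b x) :
    ∃ (N L : ℕ) (y w z : ℝ), x * (k + y) = 1 ∧ y * (N + w) = 1 ∧ 0 < w ∧ w < 1 ∧
      0 ≤ z ∧ z ≤ 1 ∧ 0 < N ∧ 1 ≤ L ∧ b ^ L ≤ b * N ∧
      (k * (b : ℝ) ^ L + (N + z)) * (k * (N + w) + 1) = b * (b : ℝ) ^ L * (N + w) := by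
  obtain ⟨a, ha, hcf, hsum⟩ := hx
  have hb2 : 2 ≤ b := by nlinarith
  have hbR : (0 : ℝ) < b := by positivity
  obtain ⟨y, hcf1, hy0, hy1, hxy⟩ := IsCF.exists_tail ha hcf
  obtain ⟨w, -, hw0, hw1, hyw⟩ := hcf1.exists_tail fun i => ha _
  have hsum0 : x = concatVal b a := hsum
  rw [concatVal_eq hb2] at hsum0
  have hz0 := concatVal_nonneg b fun i => a (i + 1)
  have hz1 := concatVal_le_one hb2 fun i => a (i + 1)
  have hzeq := concatVal_eq hb2 fun i => a (i + 1)
  set z1 := concatVal b fun i => a (i + 1)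
  have ha0 : (0 : ℝ) < a 0 := by exact_mod_cast ha 0
  have hlt : a 0 < b := by
    by_contra! hge
    have h1 : b ^ digLen b (a 0) ≤ b * a 0 :=
      Nat.base_pow_length_digits_le b (a 0) (by omega) (ha 0).ne'
    have h1R : (b : ℝ) ^ digLen b (a 0) ≤ b * a 0 := by exact_mod_cast h1
    have hgeR : (b : ℝ) ≤ a 0 := by exact_mod_cast hge
    have hpos : (0 : ℝ) < (b : ℝ) ^ digLen b (a 0) := by positivity
    rw [hsum0, div_mul_eq_mul_div, div_eq_one_iff_eq hpos.ne'] at hxy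
    nlinarith
  have hlen : digLen b (a 0) = 1 := by
    rw [digLen, Nat.digits_of_lt b (a 0) (ha 0).ne' hlt]; rfl
  rw [hlen, pow_one] at hsum0
  have hprod : (a 0 + z1) * (a 0 + y) = b := by
    rw [hsum0] at hxy
    field_simp at hxy
    linarith
  have hak : a 0 = k := by
    have h1 : (a 0 : ℝ) ^ 2 < b := by nlinarith
    have h2 : (b : ℝ) < (a 0 + 1) ^ 2 := by nlinarith
    have h1' : a 0 ^ 2 < b := by exact_mod_cast h1
    have h2' : b < (a 0 + 1) ^ 2 := by exact_mod_cast h2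
    have h3 := lt_of_pow_lt_pow_left₀ 2 (by omega) (h1'.trans hb')
    have h4 := lt_of_pow_lt_pow_left₀ 2 (by omega) (hb.trans h2')
    omega
  rw [hak] at hxy hprod
  refine ⟨a 1, digLen b (a 1), y, w, concatVal b fun i => a (i + 1 + 1), hxy, hyw, hw0, hw1,
    concatVal_nonneg _ _, concatVal_le_one hb2 _, ha 1, ?_,
    Nat.base_pow_length_digits_le b (a 1) (by omega) (ha 1).ne', ?_⟩
  · exact List.length_pos_iff.2 (Nat.digits_ne_nil_iff_ne_zero.2 (ha 1).ne')
  · simp only [zero_add] at hzeq hyw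
    set z2 := concatVal b fun i => a (i + 1 + 1)
    have hpos : (0 : ℝ) < (b : ℝ) ^ digLen b (a 1) := by positivity
    rw [eq_div_iff hpos.ne'] at hzeq
    calc _ = (k * (b : ℝ) ^ digLen b (a 1) + z1 * (b : ℝ) ^ digLen b (a 1))
          * (k * (a 1 + w) + y * (a 1 + w)) := by rw [hzeq, hyw]
      _ = ((k + z1) * (k + y)) * (b : ℝ) ^ digLen b (a 1) * (a 1 + w) := by ring
      _ = _ := by rw [hprod]

/-- The second block of a Trott number in base `k² + 1`, scaled by `k`, lies about `b` below a
power of `b`. -/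
lemma lower_base_bounds {k N B : ℤ} {w z : ℝ} (hk : 2 ≤ k) (hN : 0 < N)
    (hw0 : 0 < w) (hw1 : w < 1) (hz0 : 0 ≤ z) (hz1 : z ≤ 1) (hB : 0 < B)
    (h : ((k : ℝ) * B + (N + z)) * (k * (N + w) + 1) = (k ^ 2 + 1) * B * (N + w)) :
    (k ^ 2 + 1) * B ≤ (B - k * N) * (k * N + k + 1) ∧
      (k < B - k * N → (B - k * N - k) * (k * N + 1) ≤ (k ^ 2 + 1) * B) := by
  have hkR : (2 : ℝ) ≤ k := by exact_mod_cast hk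
  have hNR : (0 : ℝ) < N := by exact_mod_cast hN
  have hBR : (0 : ℝ) < B := by exact_mod_cast hB
  have hR : (0 : ℝ) < k * (N + w) + 1 := by positivity
  have key : ((B : ℝ) - k * N - k * z) * (k * (N + w) + 1) = (k ^ 2 + 1) * B := by
    linear_combination (-(k : ℝ)) * h
  constructor
  · have hs : (0 : ℝ) < B - k * N := by
      have : 0 < ((B : ℝ) - k * N - k * z) := by
        by_contra! hneg
        nlinarith [mul_nonneg_of_nonpos_of_nonpos hneg (neg_nonpos.2 hR.le), sq_nonneg (k : ℝ)]
      nlinarith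
    have : ((k : ℝ) ^ 2 + 1) * B ≤ (B - k * N) * (k * N + k + 1) := by
      rw [← key]
      exact mul_le_mul (by nlinarith) (by nlinarith) hR.le hs.le
    exact_mod_cast this
  · intro hs
    have hsR : (0 : ℝ) < B - k * N - k := by
      have : (k : ℝ) < B - k * N := by exact_mod_cast hs
      linarith
    have : ((B : ℝ) - k * N - k) * (k * N + 1) ≤ (k ^ 2 + 1) * B := by
      rw [← key]
      gcongr
      · nlinarith
      · nlinarith
      · linarith
    exact_mod_cast this

/-- The second block of a Trott number in base `k² + k` lies about `2` below a power of the
base. -/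
lemma upper_base_bounds {k N C : ℤ} {w z : ℝ} (hk : 2 ≤ k) (hN : 0 < N)
    (hw0 : 0 < w) (hw1 : w < 1) (hz0 : 0 ≤ z) (hz1 : z ≤ 1) (hC : 0 < C)
    (h : ((k : ℝ) * C + (N + z)) * (k * (N + w) + 1) = (k ^ 2 + k) * C * (N + w)) :
    C * (k + 1) ≤ (C - N) * (k * N + k + 1) ∧
      (1 < C - N → (C - N - 1) * (k * N + 1) ≤ C * (k + 1)) := by
  have hkR : (2 : ℝ) ≤ k := by exact_mod_cast hk
  have hNR : (0 : ℝ) < N := by exact_mod_cast hN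
  have hCR : (0 : ℝ) < C := by exact_mod_cast hC
  have hR : (0 : ℝ) < k * (N + w) + 1 := by positivity
  have key : ((C : ℝ) - N - z) * (k * (N + w) + 1) = C * (k + 1) := by
    linear_combination -h
  constructor
  · have hs : (0 : ℝ) < C - N := by
      have : 0 < ((C : ℝ) - N - z) := by
        by_contra! hneg
        nlinarith [mul_nonneg_of_nonpos_of_nonpos hneg (neg_nonpos.2 hR.le)]
      linarith
    have : (C : ℝ) * (k + 1) ≤ (C - N) * (k * N + k + 1) := by
      rw [← key]
      exact mul_le_mul (by linarith) (by nlinarith) hR.le hs.le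
    exact_mod_cast this
  · intro hs
    have hsR : (0 : ℝ) < C - N - 1 := by
      have : (1 : ℝ) < C - N := by exact_mod_cast hs
      linarith
    have : ((C : ℝ) - N - 1) * (k * N + 1) ≤ C * (k + 1) := by
      rw [← key]
      gcongr
      · linarith
      · linarith
    exact_mod_cast this

/-- In base `k² + k` the second block is exactly the power of the base minus `2`. -/
lemma upper_base_eq {k N C : ℤ} (hk : 2 ≤ k) (hN : k ^ 2 + 1 ≤ N) (hC : k = 2 → 6 ∣ C)
    (h1 : C * (k + 1) ≤ (C - N) * (k * N + k + 1))
    (h2 : 1 < C - N → (C - N - 1) * (k * N + 1) ≤ C * (k + 1)) (hC0 : 0 < C) : N = C - 2 := by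
  obtain ⟨u, rfl⟩ : ∃ u, C = N + 1 + u := ⟨C - N - 1, by ring⟩
  have hN1 : 5 ≤ N := by nlinarith
  have hu : 0 < u := by
    by_contra! hu
    have hpos : 0 < k * N + k + 1 := by positivity
    have : 0 < u + 1 := by
      by_contra! hneg
      nlinarith
    obtain rfl : u = 0 := by omega
    nlinarith
  have h3 : u * (k * N - k) ≤ (N + 1) * (k + 1) := by
    have := h2 (by linarith)
    nlinarith
  by_contra hne
  have hu2 : 2 ≤ u := by omega
  rcases hk.eq_or_lt with rfl | hk3
  · have h6 := hC rfl
    have hN7 : N ≤ 7 := by nlinarith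
    have hu3 : u < 3 := by nlinarith
    omega
  · have h4 : N * (k - 1) ≤ 3 * k + 1 := by
      have := mul_nonneg (sub_nonneg.2 hu2) (by nlinarith : 0 ≤ k * N - k)
      nlinarith
    nlinarith

/-- In base `k² + 1` there are only two candidates for the second block. -/
lemma lower_base_eq {k N B r : ℤ} (hk : 2 ≤ k) (hN : 0 < N) (hBb : k ^ 2 + 1 ≤ B)
    (hr : B - k * N = 1 + k * r)
    (hbig : k ^ 2 + 1 < B → (k ^ 2 + 1) ^ 2 ≤ B ∧ k ^ 2 + 1 ≤ N)
    (h1 : (k ^ 2 + 1) * B ≤ (B - k * N) * (k * N + k + 1))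
    (h2 : k < B - k * N → (B - k * N - k) * (k * N + 1) ≤ (k ^ 2 + 1) * B) :
    k ^ 2 + 1 ≤ N ∧ k ≤ r ∧ (r ≤ k + 1 ∨ (k = 2 ∧ N ≤ 9)) := by
  have hkN : 0 < k * N := by positivity
  have hs : 0 < B - k * N := by
    by_contra! hneg
    nlinarith
  have hkr : k ≤ r := by
    by_contra! hlt
    have hsle : B - k * N ≤ k ^ 2 + 1 - k := by rw [hr]; nlinarith
    have h3 : (k ^ 2 + 1) * B ≤ (B - k * N) * (B + k) :=
      h1.trans (mul_le_mul_of_nonneg_left (by linarith) hs.le)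
    have h4 : (B - k * N) * (B + k) ≤ (k ^ 2 + 1 - k) * (B + k) :=
      mul_le_mul_of_nonneg_right hsle (by linarith)
    nlinarith
  obtain ⟨hB2, hNb⟩ := hbig (by nlinarith)
  refine ⟨hNb, hkr, ?_⟩
  by_contra! hcon
  obtain ⟨hr2, hN9⟩ := hcon
  obtain ⟨u, hu⟩ : ∃ u, u = B - k * N - k := ⟨_, rfl⟩
  have hule : k ^ 2 + 1 + k ≤ u := by rw [hu, hr]; nlinarith
  have hB : B = k * N + u + k := by linarith
  have h3 := h2 (by nlinarith)
  rw [← hu] at h3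
  have h4 : u * (N - k) ≤ (k ^ 2 + 1) * (N + 1) := by
    have : k * (u * (N - k)) ≤ k * ((k ^ 2 + 1) * (N + 1)) := by rw [hB] at h3; linarith
    exact le_of_mul_le_mul_left this (by linarith)
  have hNk : 0 < N - k := by nlinarith
  have h5 : (k ^ 2 + 1 + k) * (N - k) ≤ (k ^ 2 + 1) * (N + 1) :=
    (mul_le_mul_of_nonneg_right hule hNk.le).trans h4
  have h6 : N ≤ k ^ 2 + 2 * k + 1 := by
    have h8 : k * N ≤ (k ^ 2 + 1) * (k + 1) + k ^ 2 := by linarith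
    by_contra! h9
    have := mul_le_mul_of_nonneg_left (Int.add_one_le_iff.2 h9) (by linarith : 0 ≤ k)
    linarith
  rcases hk.eq_or_lt with rfl | hk3
  · exact absurd (hN9 rfl) (by linarith)
  · have h7 : u ≤ 3 * (k ^ 2 + 1) := by
      by_contra! h8
      have := mul_lt_mul_of_pos_right h8 hNk
      have : 0 ≤ (k ^ 2 + 1) * (2 * N - 3 * k - 1) :=
        mul_nonneg (by positivity) (by nlinarith)
      linarith
    have h9 : (k ^ 2 + 1) ^ 2 ≤ k * (k ^ 2 + 2 * k + 1) + 3 * (k ^ 2 + 1) + k := by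
      have := mul_le_mul_of_nonneg_left h6 (by linarith : 0 ≤ k)
      linarith
    have h10 : 0 ≤ k ^ 3 * (k - 3) := mul_nonneg (by positivity) (by linarith)
    have h11 : 0 ≤ k ^ 2 * (k - 3) := mul_nonneg (by positivity) (by linarith)
    have h12 : 0 ≤ k * (k - 3) := mul_nonneg (by positivity) (by linarith)
    linarith

/-- For `k ≥ 2`, no number is Trott in both base `k²+1` and base `k²+k`. -/
theorem trott_not_both_extremes (k : ℕ) (hk : 2 ≤ k) :
    TrottSet (k ^ 2 + 1) ∩ TrottSet (k ^ 2 + k) = ∅ := by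
  rw [Set.eq_empty_iff_forall_notMem]
  rintro x ⟨hxb, hxc⟩
  obtain ⟨N, L, y, w, z, hxy, hyw, hw0, hw1, hz0, hz1, hN, hL, hLN, hb⟩ :=
    IsTrott.exists_two_steps (k := k) (by omega) (by omega) (by nlinarith) hxb
  obtain ⟨N', M, y', w', z', hxy', hyw', hw0', hw1', hz0', hz1', -, hM, -, hc⟩ :=
    IsTrott.exists_two_steps (k := k) (by omega) (by omega) (by nlinarith) hxc
  have hx0 : x ≠ 0 := by rintro rfl; simp at hxy
  obtain rfl : y = y' := by
    have := mul_left_cancel₀ hx0 (hxy.trans hxy'.symm)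
    linarith
  have hy0 : y ≠ 0 := by rintro rfl; simp at hyw
  obtain rfl : N = N' :=
    nat_eq_of_add_frac_eq hw0 hw1 hw0' hw1' (mul_left_cancel₀ hy0 (hyw.trans hyw'.symm))
  obtain ⟨B, hBdef⟩ : ∃ B : ℤ, B = ((k : ℤ) ^ 2 + 1) ^ L := ⟨_, rfl⟩
  obtain ⟨C, hCdef⟩ : ∃ C : ℤ, C = ((k : ℤ) ^ 2 + k) ^ M := ⟨_, rfl⟩
  have hkZ : (2 : ℤ) ≤ k := by exact_mod_cast hk
  have hNZ : (0 : ℤ) < N := by exact_mod_cast hN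
  have hB0 : 0 < B := by rw [hBdef]; positivity
  have hC0 : 0 < C := by rw [hCdef]; positivity
  obtain ⟨lb1, lb2⟩ := lower_base_bounds (k := k) (N := N) (B := B) hkZ hNZ hw0 hw1 hz0 hz1 hB0
    (by rw [hBdef]; push_cast at hb ⊢; exact hb)
  obtain ⟨ub1, ub2⟩ := upper_base_bounds (k := k) (N := N) (C := C) hkZ hNZ hw0' hw1' hz0' hz1' hC0
    (by rw [hCdef]; push_cast at hc ⊢; exact hc)
  obtain ⟨m, hm⟩ : (k : ℤ) ^ 2 ∣ B - 1 := by
    have := sub_one_dvd_pow_sub_one ((k : ℤ) ^ 2 + 1) L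
    rwa [add_sub_cancel_right, ← hBdef] at this
  have hBb : (k : ℤ) ^ 2 + 1 ≤ B := by
    rw [hBdef]; exact le_self_pow₀ (by nlinarith) (by omega)
  have hLNZ : B ≤ ((k : ℤ) ^ 2 + 1) * N := by rw [hBdef]; exact_mod_cast hLN
  have hbig : (k : ℤ) ^ 2 + 1 < B → ((k : ℤ) ^ 2 + 1) ^ 2 ≤ B ∧ (k : ℤ) ^ 2 + 1 ≤ N := by
    intro hlt
    have hL2 : 2 ≤ L := by
      by_contra! hL1
      obtain rfl : L = 1 := by omega
      simp [hBdef] at hlt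
    have h2 : ((k : ℤ) ^ 2 + 1) ^ 2 ≤ B := by
      rw [hBdef]; exact pow_le_pow_right₀ (by nlinarith) hL2
    refine ⟨h2, ?_⟩
    have h3 : ((k : ℤ) ^ 2 + 1) * (k ^ 2 + 1) ≤ (k ^ 2 + 1) * N := by nlinarith
    exact le_of_mul_le_mul_left h3 (by positivity)
  obtain ⟨hNb, hkr, hr⟩ := lower_base_eq (r := k * m - N) hkZ hNZ hBb
    (by linear_combination hm) hbig lb1 lb2
  have hcC : (k : ℤ) ^ 2 + k ∣ C := by rw [hCdef]; exact dvd_pow_self _ (by omega)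
  have hNC : (N : ℤ) = C - 2 := by
    refine upper_base_eq hkZ hNb (fun hk2 => ?_) ub1 ub2 hC0
    rw [hk2] at hcC
    exact hcC
  rcases hk.eq_or_lt with rfl | hk3
  · -- here `2 * 6 ^ M + 1 = 5 ^ L` or `2 * 6 ^ M + 3 = 5 ^ L`
    have h5B : (5 : ℤ) ∣ B := by rw [hBdef]; exact dvd_pow_self _ (by omega)
    have h3B : ¬ (3 : ℤ) ∣ B := by
      rw [hBdef]
      intro h
      have := Int.prime_three.dvd_of_dvd_pow h
      norm_num at this
    have h5C : (5 : ℤ) ∣ C - 1 := by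
      rw [hCdef]
      exact sub_one_dvd_pow_sub_one (6 : ℤ) M
    have h36 : N ≤ 9 → False := by
      intro h9
      have hM2 : M < 2 := by
        by_contra! hM2
        have : (6 : ℤ) ^ 2 ≤ C := by
          rw [hCdef]; exact pow_le_pow_right₀ (by norm_num) hM2
        omega
      obtain rfl : M = 1 := by omega
      norm_num at hCdef hNb
      omega
    push_cast at *
    omega
  · have hkC : (k : ℤ) ∣ C := (Dvd.intro (k + 1 : ℤ) (by ring)).trans hcC
    obtain ⟨d, hd⟩ := hkC
    have hk3Z : (3 : ℤ) ≤ k := by exact_mod_cast hk3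
    have hr' : (k : ℤ) * m - N ≤ k + 1 := by omega
    have hlo : -2 ≤ (k : ℤ) * (m - d - 1) := by linarith
    have hhi : (k : ℤ) * (m - d - 1) ≤ -1 := by linarith
    rcases lt_or_ge (m - d - 1) 0 with he | he
    · nlinarith
    · nlinarith
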